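/- The accidental parabolic element a = I₂I₃I₁I₃ is a regular unipotent matrix: its trace equals 3, (a − 1)³ = 0, and (a − 1)² ≠ 0 (where 1 denotes the 3×3 identity matrix). In particular a represents a parabolic element of PU(2,1) with 1 as its only eigenvalue. -/

import Mathlib

open Matrix

/-- `s₀ = √(4√5 − 5)`. -/
noncomputable def s0 : ℝ := Real.sqrt (4 * Real.sqrt 5 - 5)

/-- `α₀ = −1 + (1+√5)(1 − i·s₀)/4`. -/
noncomputable def alpha0 : ℂ :=
  -1 + (1 + (Real.sqrt 5 : ℂ)) * (1 - Complex.I * (s0 : ℂ)) / 4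

/-- Generating complex reflections of the (3,3,5;∞)-triangle group. -/
noncomputable def I1 : Matrix (Fin 3) (Fin 3) ℂ :=
  !![1, -1, alpha0; 0, -1, 0; 0, 0, -1]

noncomputable def I2 : Matrix (Fin 3) (Fin 3) ℂ :=
  !![-1, 0, 0; -1, 1, -1; 0, 0, -1]

noncomputable def I3 : Matrix (Fin 3) (Fin 3) ℂ :=
  !![-1, 0, 0; 0, -1, 0; (starRingEnd ℂ) alpha0, -1, 1]

/-- The accidental parabolic element `a = I₂I₃I₁I₃`. -/
noncomputable def a : Matrix (Fin 3) (Fin 3) ℂ := I2 * I3 * I1 * I3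

theorem alpha0_re : alpha0.re = (Real.sqrt 5 - 3) / 4 := by
  simp [alpha0]
  ring

theorem alpha0_im : alpha0.im = -((1 + Real.sqrt 5) * s0 / 4) := by
  simp [alpha0]
  ring

theorem normSq_alpha0 : Complex.normSq alpha0 = 2 * alpha0.re + 3 := by
  have h5 : Real.sqrt 5 ^ 2 = 5 := Real.sq_sqrt (by norm_num)
  have hs : s0 ^ 2 = 4 * Real.sqrt 5 - 5 :=
    Real.sq_sqrt (by nlinarith [Real.sqrt_nonneg 5])
  rw [Complex.normSq_apply, alpha0_re, alpha0_im]
  linear_combination (1 + Real.sqrt 5) ^ 2 / 16 * hs + (Real.sqrt 5 + 1) / 4 * h5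

theorem alpha0_add_conj_relation :
    (alpha0 + (starRingEnd ℂ) alpha0 + 2) ^ 2 = alpha0 + (starRingEnd ℂ) alpha0 + 3 := by
  have h5 : Real.sqrt 5 ^ 2 = 5 := Real.sq_sqrt (by norm_num)
  rw [Complex.add_conj, alpha0_re]
  norm_cast
  linear_combination (1 / 4) * h5

theorem alpha0_mul_conj :
    alpha0 * (starRingEnd ℂ) alpha0 = alpha0 + (starRingEnd ℂ) alpha0 + 3 := by
  rw [Complex.mul_conj, Complex.add_conj, normSq_alpha0]
  norm_cast

/-- The entries of `a - 1` as polynomials in `α₀` and its conjugate. -/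
theorem a_sub_one_eq {x y : ℂ} (hx : alpha0 = x) (hy : (starRingEnd ℂ) x = y) :
    a - 1 = !![x * y - 2, 1 - x, x;
      (1 - y) * (x * y - 1) + y, (1 - y) * (1 - x) - 2, (1 - y) * x + 1;
      2 * y - x * y ^ 2, x * y - y, -(x * y)] := by
  simp only [a, I1, I2, I3, hx, hy]
  ext i j
  fin_cases i <;> fin_cases j <;> simp <;> grind

theorem accidental_parabolic_regular_unipotent :
    a.trace = 3 ∧ (a - 1) ^ 3 = 0 ∧ (a - 1) ^ 2 ≠ 0 := by
  have hmul := alpha0_mul_conj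
  have hadd := alpha0_add_conj_relation
  have hne : alpha0 + 1 ≠ 0 := fun h => by
    have hre := congrArg Complex.re h
    simp only [Complex.add_re, alpha0_re, Complex.one_re, Complex.zero_re] at hre
    linarith [Real.sqrt_nonneg 5]
  generalize hx : alpha0 = x at hmul hadd hne
  generalize hy : (starRingEnd ℂ) x = y at hmul hadd
  have ha := a_sub_one_eq hx hy
  refine ⟨?_, ?_, fun h => hne ?_⟩
  · have htr := congrArg Matrix.trace ha
    simp only [Matrix.trace_sub, Matrix.trace_one, Matrix.trace_fin_three] at htr ⊢
    simp at htr
    linear_combination htr + hmul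
  · rw [ha]
    ext i j
    fin_cases i <;> fin_cases j <;> simp [pow_succ, Matrix.mul_apply, Fin.sum_univ_succ] <;> grind
  · rw [ha] at h
    have h02 := congrFun (congrFun h 0) 2
    simp [pow_succ, Matrix.mul_apply, Fin.sum_univ_succ] at h02
    grind
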